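/- Let r ≥ 2, let k be a positive integer, and let H be a fixed graph with chromatic number χ(H) = r + 1. Then ex_φ(n, H) = ex_φ(n, K_{r+1}) + o(n^{k+1}); precisely, for every ε > 0 there exists N such that for all n ≥ N, ex_φ(n, K_{r+1}) ≤ ex_φ(n, H) ≤ ex_φ(n, K_{r+1}) + ε·n^{k+1}. -/

import Mathlib

open Finset
open scoped Classical

/-- `e_φ(G) = Σ_v C(deg_G(v), k)`, the sum of `k`-th binomial coefficients of the degrees. -/
noncomputable def ePhi {V : Type*} [Fintype V] (G : SimpleGraph V) (k : ℕ) : ℕ :=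
  ∑ v, (G.degree v).choose k

/-- `G` contains a copy of `H` as a subgraph (an injective graph homomorphism). -/
def ContainsCopy {α β : Type*} (H : SimpleGraph α) (G : SimpleGraph β) : Prop :=
  ∃ f : α → β, Function.Injective f ∧ ∀ a b, H.Adj a b → G.Adj (f a) (f b)

/-- `ex_φ(n, H)`: the maximum of `e_φ(G)` over `H`-free graphs `G` on `n` vertices. -/
noncomputable def exPhi (n k : ℕ) {α : Type*} (H : SimpleGraph α) : ℕ :=
  sSup {m : ℕ | ∃ G : SimpleGraph (Fin n), ¬ ContainsCopy H G ∧ ePhi G k = m}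

lemma exists_forall_pow_sub_descFactorial_le (t : ℕ) {ε : ℝ} (hε : 0 < ε) :
    ∃ N : ℕ, ∀ n : ℕ, N ≤ n → (n : ℝ) ^ t - (n.descFactorial t : ℝ) ≤ ε * (n : ℝ) ^ t := by
  have h := ((isEquivalent_descFactorial t).isLittleO.def hε)
  obtain ⟨N, hN⟩ := Filter.eventually_atTop.1 h
  refine ⟨N, fun n hn => ?_⟩
  have h1 := hN n hn
  simp only [Pi.sub_apply, Real.norm_eq_abs] at h1
  rw [abs_of_nonneg (by positivity : (0 : ℝ) ≤ (n : ℝ) ^ t)] at h1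
  have := neg_abs_le ((n.descFactorial t : ℝ) - (n : ℝ) ^ t)
  linarith

lemma card_filter_injective (t n : ℕ) :
    #{T : Fin t → Fin n | Function.Injective T} = n.descFactorial t := by
  rw [← Fintype.card_subtype,
    Fintype.card_congr (Equiv.subtypeInjectiveEquivEmbedding (Fin t) (Fin n))]
  simp [Fintype.card_embedding_eq]

/-- A dense family of `m`-tuples contains a box whose sides are sets of prescribed size. -/
lemma exists_box_subset_of_dense (t m : ℕ) : ∀ δ : ℝ, 0 < δ → ∃ N : ℕ, ∀ n : ℕ, N ≤ n →
    ∀ R : Finset (Fin m → Fin n), δ * (n : ℝ) ^ m ≤ #R →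
      ∃ A : Fin m → Fin (t + 1) → Fin n, (∀ i, Function.Injective (A i)) ∧
        ∀ j : Fin m → Fin (t + 1), (fun i => A i (j i)) ∈ R := by
  induction m with
  | zero =>
    intro δ hδ
    refine ⟨0, fun n _ R hR => ⟨fun i => i.elim0, fun i => i.elim0, fun j => ?_⟩⟩
    have hpos : 0 < #R := by
      have : (0 : ℝ) < #R := by simp at hR; linarith
      exact_mod_cast this
    obtain ⟨x, hx⟩ := card_pos.1 hpos
    convert hx
  | succ m ih =>
    intro δ hδ
    have hδ' : 0 < δ ^ (t + 1) / 3 := by positivity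
    obtain ⟨N₁, hN₁⟩ := ih _ hδ'
    obtain ⟨N₂, hN₂⟩ := exists_forall_pow_sub_descFactorial_le (t + 1) hδ'
    refine ⟨max 1 (max N₁ N₂), fun n hn R hR => ?_⟩
    have hn1 : 1 ≤ n := le_trans (le_max_left _ _) hn
    have hnN₁ : N₁ ≤ n := le_trans (le_trans (le_max_left _ _) (le_max_right _ _)) hn
    have hnN₂ : N₂ ≤ n := le_trans (le_trans (le_max_right _ _) (le_max_right _ _)) hn
    have hn0 : (0 : ℝ) < n := by exact_mod_cast hn1
    let S : (Fin (t + 1) → Fin n) → Finset (Fin m → Fin n) :=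
      fun T => {y | ∀ i, (Fin.cons (T i) y : Fin (m + 1) → Fin n) ∈ R}
    let D : (Fin m → Fin n) → Finset (Fin n) :=
      fun y => {v | (Fin.cons v y : Fin (m + 1) → Fin n) ∈ R}
    have hDsum : ∑ y, #(D y) = #R := by
      have h1 : #R = ∑ x : Fin (m + 1) → Fin n, if x ∈ R then 1 else 0 := by simp
      have h2 : (∑ x : Fin (m + 1) → Fin n, if x ∈ R then 1 else 0) =
          ∑ p : Fin n × (Fin m → Fin n),
            if (Fin.cons p.1 p.2 : Fin (m + 1) → Fin n) ∈ R then 1 else 0 :=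
        ((Fin.consEquiv fun _ : Fin (m + 1) => Fin n).sum_comp _).symm
      rw [h1, h2, Fintype.sum_prod_type_right]
      exact sum_congr rfl fun y _ => card_filter _ _
    have hswap : ∑ T, #(S T) = ∑ y, #(D y) ^ (t + 1) := by
      simp only [S, card_filter]
      rw [sum_comm]
      refine sum_congr rfl fun y _ => ?_
      rw [← card_filter]
      have : ({T | ∀ i, (Fin.cons (T i) y : Fin (m + 1) → Fin n) ∈ R} :
          Finset (Fin (t + 1) → Fin n)) = Fintype.piFinset fun _ => D y := by
        ext T; simp [D, Fintype.mem_piFinset]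
      rw [this]; simp
    have hlow : δ ^ (t + 1) * (n : ℝ) ^ m * (n : ℝ) ^ (t + 1) ≤ ∑ T, (#(S T) : ℝ) := by
      have hpm := pow_sum_le_card_mul_sum_pow (s := (univ : Finset (Fin m → Fin n)))
        (f := fun y => (#(D y) : ℝ)) (fun _ _ => by positivity) t
      have e1 : ∑ y, (#(D y) : ℝ) = #R := by exact_mod_cast hDsum
      have e2 : ∑ T, (#(S T) : ℝ) = ∑ y, (#(D y) : ℝ) ^ (t + 1) := by exact_mod_cast hswap
      rw [e1, ← e2] at hpm
      have h3 : (δ * (n : ℝ) ^ (m + 1)) ^ (t + 1) ≤ (#R : ℝ) ^ (t + 1) :=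
        pow_le_pow_left₀ (by positivity) hR _
      have h4 : (((n : ℝ) ^ m) ^ t) * (δ ^ (t + 1) * (n : ℝ) ^ m * (n : ℝ) ^ (t + 1)) =
          (δ * (n : ℝ) ^ (m + 1)) ^ (t + 1) := by ring
      have h5 : ((#(univ : Finset (Fin m → Fin n)) : ℕ) : ℝ) = (n : ℝ) ^ m := by simp
      rw [h5] at hpm
      refine le_of_mul_le_mul_left (a := ((n : ℝ) ^ m) ^ t) ?_ (by positivity)
      rw [h4]; exact h3.trans hpm
    obtain ⟨T, hT, hTS⟩ : ∃ T : Fin (t + 1) → Fin n, Function.Injective T ∧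
        δ ^ (t + 1) / 3 * (n : ℝ) ^ m ≤ #(S T) := by
      by_contra! hcon
      have hup : ∑ T, (#(S T) : ℝ) ≤ ∑ T : Fin (t + 1) → Fin n,
          (δ ^ (t + 1) / 3 * (n : ℝ) ^ m +
            (1 - if Function.Injective T then (1 : ℝ) else 0) * (n : ℝ) ^ m) := by
        refine sum_le_sum fun T _ => ?_
        split_ifs with h
        · simpa using (hcon T h).le
        · have : (#(S T) : ℝ) ≤ (n : ℝ) ^ m := by
            have := card_le_univ (S T)
            simp only [Fintype.card_pi, Fintype.card_fin, prod_const, card_univ] at this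
            exact_mod_cast this
          have : 0 ≤ δ ^ (t + 1) / 3 * (n : ℝ) ^ m := by positivity
          linarith
      have hinj : ∑ T : Fin (t + 1) → Fin n, (if Function.Injective T then (1 : ℝ) else 0) =
          n.descFactorial (t + 1) := by
        rw [← card_filter_injective, card_filter]; push_cast; rfl
      rw [sum_add_distrib, sum_const, ← sum_mul, sum_sub_distrib, hinj] at hup
      simp only [sum_const, card_univ, Fintype.card_pi, Fintype.card_fin, prod_const,
        nsmul_eq_mul, Nat.cast_pow, mul_one] at hup
      have h6 := mul_le_mul_of_nonneg_right (hN₂ n hnN₂) (by positivity : (0 : ℝ) ≤ (n : ℝ) ^ m)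
      have h7 : 0 < δ ^ (t + 1) * (n : ℝ) ^ m * (n : ℝ) ^ (t + 1) := by positivity
      nlinarith
    obtain ⟨A, hA, hAS⟩ := hN₁ n hnN₁ (S T) hTS
    refine ⟨Fin.cons T A, fun i => ?_, fun j => ?_⟩
    · refine Fin.cases ?_ (fun i => ?_) i
      · simpa using hT
      · simpa using hA i
    · have h8 := hAS fun i => j i.succ
      simp only [S, mem_filter, mem_univ, true_and] at h8
      convert h8 (j 0) using 1
      ext i
      refine Fin.cases ?_ (fun i => ?_) i <;> simp

/-- A large `H`-free graph, with `H` being `q`-colourable, has a small density of copies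
of `K_q`. -/
lemma exists_forall_card_clique_hom_le {α : Type*} [Fintype α] (H : SimpleGraph α) (q : ℕ)
    (hH : H.Colorable q) {δ : ℝ} (hδ : 0 < δ) :
    ∃ N : ℕ, ∀ n : ℕ, N ≤ n → ∀ G : SimpleGraph (Fin n),
      ¬ ContainsCopy H G →
      (#{h : Fin q → Fin n | ∀ i j, i ≠ j → G.Adj (h i) (h j)} : ℝ) ≤ δ * (n : ℝ) ^ q := by
  obtain ⟨N, hN⟩ := exists_box_subset_of_dense (Fintype.card α) q δ hδ
  refine ⟨N, fun n hn G hG => ?_⟩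
  by_contra! hlt
  obtain ⟨A, hA, hbox⟩ := hN n hn _ hlt.le
  obtain ⟨c⟩ := hH
  let e : α → Fin (Fintype.card α + 1) := fun a => (Fintype.equivFin α a).castSucc
  have he : Function.Injective e :=
    (Fin.castSucc_injective _).comp (Fintype.equivFin α).injective
  have hadj : ∀ a b, c a ≠ c b → G.Adj (A (c a) (e a)) (A (c b) (e b)) := by
    intro a b hab
    have := hbox fun i => if i = c a then e a else e b
    simp only [mem_filter, mem_univ, true_and] at this
    simpa [hab.symm] using this (c a) (c b) hab
  refine hG ⟨fun a => A (c a) (e a), fun a b hab => ?_, fun a b h => hadj a b (c.valid h)⟩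
  by_cases hc : c a = c b
  · simp only [hc] at hab
    exact he (hA _ hab)
  · exact absurd hab (hadj a b hc).ne

/-- Erdős' degree majorization: a graph without a clique of size `r + 1` on `s` is dominated in
degree, vertex by vertex, by a complete `r`-partite graph on `s`. -/
lemma exists_coloring_degree_le {V : Type*} [Fintype V] (G : SimpleGraph V) (r : ℕ) :
    ∀ s : Finset V, G.CliqueFreeOn s (r + 1) →
      ∃ c : V → ℕ, (∀ v ∈ s, c v < r) ∧
        ∀ v ∈ s, #{u ∈ s | G.Adj v u} ≤ #{u ∈ s | c v ≠ c u} := by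
  induction r with
  | zero =>
    intro s hs
    have : s = ∅ := by
      by_contra hne
      obtain ⟨v, hv⟩ := nonempty_iff_ne_empty.2 hne
      exact hs (t := {v}) (by simpa using hv) (by simp)
    subst this
    exact ⟨fun _ => 0, by simp, by simp⟩
  | succ r ih =>
    intro s hs
    rcases s.eq_empty_or_nonempty with rfl | hne
    · exact ⟨fun _ => 0, by simp, by simp⟩
    obtain ⟨v, hv, hmax⟩ := exists_max_image s (fun v => #{u ∈ s | G.Adj v u}) hne
    set K : Finset V := {u ∈ s | G.Adj v u} with hK
    have hKs : K ⊆ s := filter_subset _ _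
    have hKfree : G.CliqueFreeOn K (r + 1) := by
      have := SimpleGraph.CliqueFreeOn.of_succ G hs (mem_coe.2 hv)
      convert this using 1
      ext u; simp [hK]
    obtain ⟨c, hc, hdeg⟩ := ih K hKfree
    refine ⟨fun u => if u ∈ K then c u else r, fun u hu => ?_, fun u hu => ?_⟩
    · dsimp only
      split_ifs with h
      · exact (hc u h).trans (Nat.lt_succ_self r)
      · exact Nat.lt_succ_self r
    · by_cases h : u ∈ K
      · have h1 : #{w ∈ s | G.Adj u w} ≤ #{w ∈ K | G.Adj u w} + #(s \ K) := by
          rw [← card_union_of_disjoint]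
          · refine card_le_card fun w hw => ?_
            simp only [mem_filter, mem_union, mem_sdiff] at hw ⊢
            tauto
          · exact disjoint_sdiff.mono_left (filter_subset _ _)
        refine (h1.trans (Nat.add_le_add_right (hdeg u h) _)).trans ?_
        rw [← card_union_of_disjoint (disjoint_sdiff.mono_left (filter_subset _ _))]
        refine card_le_card fun w hw => ?_
        simp only [mem_filter, mem_union, mem_sdiff] at hw ⊢
        rcases hw with ⟨hw, hne⟩ | ⟨hw, hwK⟩
        · simpa [h, hw, hKs hw] using hne
        · simpa [h, hw, hwK] using (hc u h).ne
      · refine (hmax u hu).trans (card_le_card fun w hw => ?_)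
        simp only [mem_filter]
        exact ⟨hKs hw, by simpa [h, hw] using (hc w hw).ne'⟩

lemma card_filter_comp_mem {ι κ V : Type*} [Fintype ι] [Fintype κ] [Fintype V] (g : κ → ι)
    (hg : Function.Injective g) (R : Finset (κ → V)) :
    #{f : ι → V | f ∘ g ∈ R} * Fintype.card V ^ Fintype.card κ =
      #R * Fintype.card V ^ Fintype.card ι := by
  have hfib : ∀ h : κ → V, #{f : ι → V | f ∘ g = h} * Fintype.card V ^ Fintype.card κ =
      Fintype.card V ^ Fintype.card ι := by
    intro h
    have hset : ({f : ι → V | f ∘ g = h} : Finset (ι → V)) =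
        Fintype.piFinset fun j => if hj : ∃ i, g i = j then {h hj.choose} else univ := by
      ext f
      simp only [mem_filter, mem_univ, true_and, Fintype.mem_piFinset]
      constructor
      · rintro rfl j
        split_ifs with hj
        · simp [hj.choose_spec]
        · simp
      · intro hf
        ext i
        have hi : ∃ i', g i' = g i := ⟨i, rfl⟩
        have := hf (g i)
        rw [dif_pos hi, mem_singleton, hg hi.choose_spec] at this
        exact this
    have hcard : ∀ j : ι, #(if hj : ∃ i, g i = j then {h hj.choose} else (univ : Finset V)) =
        if j ∈ univ.image g then 1 else Fintype.card V := by
      intro j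
      by_cases hj : ∃ i, g i = j
      · rw [dif_pos hj, if_pos (by simpa using hj), card_singleton]
      · rw [dif_neg hj, if_neg (by simpa using hj), card_univ]
    have hκ : Fintype.card V ^ Fintype.card κ =
        ∏ j : ι, if j ∈ univ.image g then Fintype.card V else 1 := by
      rw [prod_ite_mem, prod_const, univ_inter, card_image_of_injective _ hg, card_univ]
    rw [hset, Fintype.card_piFinset, prod_congr rfl fun j _ => hcard j, hκ, ← prod_mul_distrib,
      ← card_univ (α := ι), ← prod_const]
    refine prod_congr rfl fun j _ => ?_
    split_ifs <;> simp
  have hsum : #{f : ι → V | f ∘ g ∈ R} = ∑ h ∈ R, #{f : ι → V | f ∘ g = h} := by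
    rw [card_eq_sum_card_fiberwise (f := fun f : ι → V => f ∘ g) (t := R)
      (fun f hf => by simpa using hf)]
    refine sum_congr rfl fun h hh => congrArg card ?_
    ext f
    simp only [mem_filter, mem_univ, true_and]
    exact ⟨fun H => H.2, fun H => ⟨H ▸ hh, H⟩⟩
  rw [hsum, sum_mul, sum_congr rfl fun h _ => hfib h, sum_const, smul_eq_mul]

lemma card_filter_star {ι V : Type*} [Fintype ι] [Fintype V] (G : SimpleGraph V) (i : ι)
    (T : Finset ι) (hi : i ∉ T) :
    #{f : ι → V | ∀ j ∈ T, G.Adj (f i) (f j)} * Fintype.card V ^ (#T + 1) =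
      Fintype.card V ^ Fintype.card ι * ∑ v, G.degree v ^ #T := by
  have hsum : #{f : ι → V | ∀ j ∈ T, G.Adj (f i) (f j)} =
      ∑ v, #{f : ι → V | f i = v ∧ ∀ j ∈ T, G.Adj v (f j)} := by
    rw [card_eq_sum_card_fiberwise (f := fun f : ι → V => f i) (t := univ) (fun _ _ => by simp)]
    refine sum_congr rfl fun v _ => congrArg card ?_
    ext f
    simp only [mem_filter, mem_univ, true_and]
    constructor
    · rintro ⟨h, rfl⟩; exact ⟨rfl, h⟩
    · rintro ⟨rfl, h⟩; exact ⟨h, rfl⟩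
  rw [hsum, sum_mul, mul_sum]
  refine sum_congr rfl fun v _ => ?_
  have hset : ({f : ι → V | f i = v ∧ ∀ j ∈ T, G.Adj v (f j)} : Finset (ι → V)) =
      Fintype.piFinset fun j => if j = i then {v} else if j ∈ T then G.neighborFinset v else univ := by
    ext f
    simp only [mem_filter, mem_univ, true_and, Fintype.mem_piFinset]
    constructor
    · rintro ⟨rfl, h⟩ j
      split_ifs with h1 h2
      · simp [h1]
      · simpa using h j h2
      · simp
    · intro h
      refine ⟨by simpa using h i, fun j hj => ?_⟩
      have hji : j ≠ i := fun e => hi (e ▸ hj)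
      simpa [hji, hj] using h j
  have hcard : ∀ j : ι, #(if j = i then {v} else if j ∈ T then G.neighborFinset v else univ) =
      if j = i then 1 else if j ∈ T then G.degree v else Fintype.card V := by
    intro j
    split_ifs <;> simp
  have h1 : Fintype.card V ^ (#T + 1) = ∏ j : ι, if j ∈ insert i T then Fintype.card V else 1 := by
    rw [prod_ite_mem, prod_const, univ_inter, card_insert_of_notMem hi]
  have h2 : G.degree v ^ #T = ∏ j : ι, if j ∈ T then G.degree v else 1 := by
    rw [prod_ite_mem, prod_const, univ_inter]
  rw [hset, Fintype.card_piFinset, prod_congr rfl fun j _ => hcard j, h1, h2, ← prod_mul_distrib,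
    ← card_univ (α := ι), ← prod_const, ← prod_mul_distrib]
  refine prod_congr rfl fun j _ => ?_
  by_cases hji : j = i
  · subst hji; simp [hi]
  · by_cases hj : j ∈ T <;> simp [hji, hj, mul_comm]

lemma ePhi_eq_sum_card {V : Type*} [Fintype V] (G : SimpleGraph V) (k : ℕ) :
    ePhi G k = ∑ i, ∑ T ∈ powersetCard k (univ.erase i), if ∀ j ∈ T, G.Adj i j then 1 else 0 := by
  refine sum_congr rfl fun i _ => ?_
  rw [← card_filter, ← G.card_neighborFinset_eq_degree, ← card_powersetCard]
  congr 1
  ext T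
  simp only [mem_powersetCard, mem_filter, subset_iff, SimpleGraph.mem_neighborFinset, mem_erase,
    mem_univ, and_true]
  constructor
  · rintro ⟨h, hc⟩; exact ⟨⟨fun j hj => (h hj).ne', hc⟩, fun j hj => h hj⟩
  · rintro ⟨⟨_, hc⟩, h⟩; exact ⟨fun j hj => h hj, hc⟩

/-- Averaging `ePhi` over all pullbacks of `G` to `M` vertices recovers the density of `k`-stars. -/
lemma sum_ePhi_comap_mul {V : Type*} [Fintype V] (G : SimpleGraph V) (M k : ℕ) :
    (∑ f : Fin M → V, ePhi (G.comap f) k) * Fintype.card V ^ (k + 1) =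
      M * (M - 1).choose k * (Fintype.card V ^ M * ∑ v, G.degree v ^ k) := by
  simp only [ePhi_eq_sum_card, SimpleGraph.comap_adj]
  rw [sum_comm, sum_mul]
  have : ∀ i : Fin M, (∑ f : Fin M → V, ∑ T ∈ powersetCard k (univ.erase i),
      if ∀ j ∈ T, G.Adj (f i) (f j) then 1 else 0) * Fintype.card V ^ (k + 1) =
      (M - 1).choose k * (Fintype.card V ^ M * ∑ v, G.degree v ^ k) := by
    intro i
    rw [sum_comm, sum_mul]
    have h : ∀ T ∈ powersetCard k (univ.erase i), (∑ f : Fin M → V,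
        if ∀ j ∈ T, G.Adj (f i) (f j) then 1 else 0) * Fintype.card V ^ (k + 1) =
        Fintype.card V ^ M * ∑ v, G.degree v ^ k := by
      intro T hT
      obtain ⟨hTs, rfl⟩ := mem_powersetCard.1 hT
      have := card_filter_star G i T fun hi => by simpa using hTs hi
      rw [card_filter, Fintype.card_fin] at this
      convert this
    rw [sum_congr rfl h, sum_const, card_powersetCard, card_erase_of_mem (mem_univ i)]
    simp
  calc _ = ∑ _i : Fin M, (M - 1).choose k * (Fintype.card V ^ M * ∑ v, G.degree v ^ k) :=
        sum_congr rfl fun i _ => by convert this i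
    _ = _ := by simp [mul_assoc]

lemma ePhi_le {n : ℕ} (G : SimpleGraph (Fin n)) (k : ℕ) : ePhi G k ≤ n * (n - 1).choose k := by
  calc ePhi G k ≤ ∑ _v : Fin n, (n - 1).choose k := by
        refine sum_le_sum fun v _ => Nat.choose_le_choose k ?_
        have := G.degree_lt_card_verts v
        simp only [Fintype.card_fin] at this
        omega
    _ = _ := by simp

lemma factorial_mul_ePhi_le {V : Type*} [Fintype V] (G : SimpleGraph V) (k : ℕ) :
    k.factorial * ePhi G k ≤ ∑ v, G.degree v ^ k := by
  rw [ePhi, mul_sum]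
  refine sum_le_sum fun v _ => ?_
  rw [← Nat.descFactorial_eq_factorial_mul_choose]
  exact Nat.descFactorial_le_pow _ _

lemma ePhi_le_exPhi {n k : ℕ} {α : Type*} {H : SimpleGraph α} {G : SimpleGraph (Fin n)}
    (hG : ¬ ContainsCopy H G) : ePhi G k ≤ exPhi n k H := by
  refine le_csSup (Set.Finite.bddAbove ?_) ⟨G, hG, rfl⟩
  refine (Set.finite_range fun G : SimpleGraph (Fin n) => ePhi G k).subset ?_
  rintro _ ⟨G, -, rfl⟩
  exact ⟨G, rfl⟩

lemma exPhi_le {n k X : ℕ} {α : Type*} {H : SimpleGraph α}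
    (h : ∀ G : SimpleGraph (Fin n), ¬ ContainsCopy H G → ePhi G k ≤ X) : exPhi n k H ≤ X := by
  refine csSup_le' ?_
  rintro _ ⟨G, hG, rfl⟩
  exact h G hG

/-- The star density of `G` is at most the extremal `K_q`-free star density on `M` vertices plus the
probability that a random `M`-tuple of vertices spans a `K_q`. -/
lemma star_density_le {n : ℕ} (hn : 0 < n) (G : SimpleGraph (Fin n)) (M k q : ℕ) :
    (M * (M - 1).choose k : ℝ) * ((∑ v, (G.degree v : ℝ) ^ k) / (n : ℝ) ^ (k + 1)) ≤
      exPhi M k (⊤ : SimpleGraph (Fin q)) + (M * (M - 1).choose k : ℝ) * ((M : ℝ) ^ q *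
        (#{h : Fin q → Fin n | ∀ i j, i ≠ j → G.Adj (h i) (h j)} / (n : ℝ) ^ q)) := by
  set R : Finset (Fin q → Fin n) := {h | ∀ i j, i ≠ j → G.Adj (h i) (h j)} with hR
  have hn0 : (0 : ℝ) < n := by exact_mod_cast hn
  set B : Finset (Fin M → Fin n) := {f | ContainsCopy (⊤ : SimpleGraph (Fin q)) (G.comap f)} with hB
  have hBcard : (#B : ℝ) * (n : ℝ) ^ q ≤ (M : ℝ) ^ q * (#R * (n : ℝ) ^ M) := by
    have hsub : B ⊆ ({g : Fin q → Fin M | Function.Injective g} : Finset _).biUnion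
        fun g => {f : Fin M → Fin n | f ∘ g ∈ R} := by
      intro f hf
      obtain ⟨g, hg, hadj⟩ := (mem_filter.1 hf).2
      simp only [mem_biUnion, mem_filter, mem_univ, true_and]
      exact ⟨g, hg, by simpa [hR] using hadj⟩
    have h1 : #B * n ^ q ≤ ∑ g ∈ ({g : Fin q → Fin M | Function.Injective g} : Finset _),
        #R * n ^ M := by
      refine (Nat.mul_le_mul_right _ ((card_le_card hsub).trans card_biUnion_le)).trans ?_
      rw [sum_mul]
      refine sum_le_sum fun g hg => ?_
      have := card_filter_comp_mem g (mem_filter.1 hg).2 R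
      simp only [Fintype.card_fin] at this
      refine le_of_eq ?_
      convert this
    have h2 : #B * n ^ q ≤ M ^ q * (#R * n ^ M) := by
      refine h1.trans ?_
      rw [sum_const, smul_eq_mul]
      refine Nat.mul_le_mul_right _ ?_
      exact (card_le_univ _).trans (by simp)
    exact_mod_cast h2
  have hsum : (∑ f : Fin M → Fin n, (ePhi (G.comap f) k : ℝ)) ≤
      (n : ℝ) ^ M * exPhi M k (⊤ : SimpleGraph (Fin q)) + #B * (M * (M - 1).choose k : ℝ) := by
    have h : ∀ f : Fin M → Fin n, ePhi (G.comap f) k ≤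
        exPhi M k (⊤ : SimpleGraph (Fin q)) + if f ∈ B then M * (M - 1).choose k else 0 := by
      intro f
      by_cases hf : f ∈ B
      · rw [if_pos hf]; exact (ePhi_le _ k).trans (Nat.le_add_left _ _)
      · rw [if_neg hf]
        exact ePhi_le_exPhi fun h => hf (by simpa [hB] using h)
    have h' := sum_le_sum fun f (_ : f ∈ (univ : Finset (Fin M → Fin n))) => h f
    rw [sum_add_distrib, sum_ite_mem, univ_inter, sum_const, sum_const, card_univ] at h'
    simp only [Fintype.card_pi, Fintype.card_fin, prod_const, card_univ, smul_eq_mul] at h'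
    exact_mod_cast h'
  have havg : (∑ f : Fin M → Fin n, (ePhi (G.comap f) k : ℝ)) * (n : ℝ) ^ (k + 1) =
      M * (M - 1).choose k * ((n : ℝ) ^ M * ∑ v, (G.degree v : ℝ) ^ k) := by
    have := sum_ePhi_comap_mul G M k
    simp only [Fintype.card_fin] at this
    exact_mod_cast this
  have hC : (0 : ℝ) ≤ M * (M - 1).choose k := by positivity
  have e1 : (M * (M - 1).choose k : ℝ) * ((∑ v, (G.degree v : ℝ) ^ k) / (n : ℝ) ^ (k + 1)) =
      (∑ f : Fin M → Fin n, (ePhi (G.comap f) k : ℝ)) / (n : ℝ) ^ M := by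
    rw [eq_div_iff (by positivity), mul_div_assoc', div_mul_eq_mul_div, div_eq_iff (by positivity),
      havg]
    ring
  have e2 : (#B : ℝ) / (n : ℝ) ^ M ≤ (M : ℝ) ^ q * (#R / (n : ℝ) ^ q) := by
    rw [div_le_iff₀ (by positivity), mul_div_assoc', div_mul_eq_mul_div, le_div_iff₀ (by positivity)]
    linarith
  rw [e1, div_le_iff₀ (by positivity)]
  rw [div_le_iff₀ (by positivity)] at e2
  have e3 := mul_le_mul_of_nonneg_left e2 hC
  linarith

/-- The extremal value for `K_{r+1}` is attained by `r`-partite graphs, which contain no graph that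
is not `r`-colourable. -/
lemma exPhi_top_le_of_not_colorable {α : Type*} (H : SimpleGraph α) (n k r : ℕ)
    (hH : ¬ H.Colorable r) : exPhi n k (⊤ : SimpleGraph (Fin (r + 1))) ≤ exPhi n k H := by
  refine exPhi_le fun G hG => ?_
  have hfree : G.CliqueFree (r + 1) := by
    by_contra h
    obtain ⟨f⟩ := SimpleGraph.not_cliqueFree_iff_top_isContained (r + 1) |>.1 h
    exact hG ⟨f, f.injective, fun a b hab => f.toHom.map_adj hab⟩
  obtain ⟨c, hc, hdeg⟩ := exists_coloring_degree_le G r univ hfree.cliqueFreeOn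
  let G' : SimpleGraph (Fin n) := (⊤ : SimpleGraph ℕ).comap c
  have hG' : ¬ ContainsCopy H G' := by
    rintro ⟨f, -, hf⟩
    refine hH ⟨SimpleGraph.Coloring.mk (fun a => (⟨c (f a), hc _ (mem_univ _)⟩ : Fin r)) ?_⟩
    intro a b hab h
    exact hf a b hab (by simpa using h)
  refine le_trans (sum_le_sum fun v _ => Nat.choose_le_choose k ?_) (ePhi_le_exPhi hG')
  have h1 : ∀ F : SimpleGraph (Fin n), F.degree v = #{u ∈ univ | F.Adj v u} := by
    intro F
    rw [← F.card_neighborFinset_eq_degree, F.neighborFinset_eq_filter]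
  rw [h1, h1]
  convert hdeg v (mem_univ v)

lemma factorial_mul_mul_choose_pred {n k : ℕ} (hn : 0 < n) :
    k.factorial * (n * (n - 1).choose k) = n.descFactorial (k + 1) := by
  obtain ⟨m, rfl⟩ := Nat.exists_eq_succ_of_ne_zero hn.ne'
  rw [Nat.succ_eq_add_one, Nat.succ_descFactorial_succ, Nat.descFactorial_eq_factorial_mul_choose,
    Nat.add_sub_cancel]
  ring

/-- The normalized extremal function has almost-minimal values from some point on. -/
lemma exists_exPhi_density_le {α : Type*} (H : SimpleGraph α) (k : ℕ) {η : ℝ} (hη : 0 < η) :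
    ∃ M, k + 1 ≤ M ∧ ∀ n, k + 1 ≤ n →
      (exPhi M k H : ℝ) / (M * (M - 1).choose k : ℕ) ≤
        (exPhi n k H : ℝ) / (n * (n - 1).choose k : ℕ) + η := by
  let S : Set ℝ := {x | ∃ M, k + 1 ≤ M ∧ (exPhi M k H : ℝ) / (M * (M - 1).choose k : ℕ) = x}
  have hbdd : BddBelow S := ⟨0, by rintro _ ⟨M, -, rfl⟩; positivity⟩
  obtain ⟨_, ⟨M, hM, rfl⟩, hlt⟩ :=
    exists_lt_of_csInf_lt (s := S) ⟨_, k + 1, le_rfl, rfl⟩ (lt_add_of_pos_right (sInf S) hη)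
  refine ⟨M, hM, fun n hn => hlt.le.trans ?_⟩
  have := csInf_le hbdd ⟨n, hn, rfl⟩
  linarith

/-- If `χ(H) = r + 1` with `r ≥ 2` and `k ≥ 1`, then
`ex_φ(n, H) = ex_φ(n, K_{r+1}) + o(n^{k+1})`: for every `ε > 0` and all sufficiently
large `n`, `ex_φ(n, K_{r+1}) ≤ ex_φ(n, H) ≤ ex_φ(n, K_{r+1}) + ε·n^{k+1}`. -/
theorem ex_phi_H_eq_ex_phi_clique_plus_little_o {α : Type*} [Fintype α] (r k : ℕ)
    (hr : 2 ≤ r) (hk : 1 ≤ k) (H : SimpleGraph α)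
    (hchrom : H.chromaticNumber = (r + 1 : ℕ)) :
    ∀ ε : ℝ, 0 < ε → ∃ N : ℕ, ∀ n : ℕ, N ≤ n →
      exPhi n k (⊤ : SimpleGraph (Fin (r + 1))) ≤ exPhi n k H ∧
      (exPhi n k H : ℝ) ≤
        (exPhi n k (⊤ : SimpleGraph (Fin (r + 1))) : ℝ) + ε * (n : ℝ) ^ (k + 1) := by
  intro ε hε
  have hcol : H.Colorable (r + 1) := SimpleGraph.chromaticNumber_le_iff_colorable.1 hchrom.le
  have hncol : ¬ H.Colorable r := fun h => by
    have := SimpleGraph.chromaticNumber_le_iff_colorable.2 h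
    rw [hchrom, Nat.cast_le] at this
    omega
  have hη : 0 < ε / 3 := by positivity
  obtain ⟨M, hM, hMn⟩ := exists_exPhi_density_le (⊤ : SimpleGraph (Fin (r + 1))) k hη
  have hM0 : (0 : ℝ) < M := by exact_mod_cast (Nat.succ_pos k).trans_le hM
  have hδ : 0 < ε / 3 / (M : ℝ) ^ (r + 1) := by positivity
  obtain ⟨N₁, hN₁⟩ := exists_forall_card_clique_hom_le H (r + 1) hcol hδ
  obtain ⟨N₂, hN₂⟩ := exists_forall_pow_sub_descFactorial_le (k + 1) hη
  refine ⟨max (k + 1) (max N₁ N₂), fun n hn =>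
    ⟨exPhi_top_le_of_not_colorable H n k r hncol, ?_⟩⟩
  simp only [max_le_iff] at hn
  obtain ⟨hkn, hnN₁, hnN₂⟩ := hn
  have hnpos : 0 < n := (Nat.succ_pos k).trans_le hkn
  have hn0 : (0 : ℝ) < n := by exact_mod_cast hnpos
  have hCpos : ∀ m, k + 1 ≤ m → (0 : ℝ) < (m * (m - 1).choose k : ℕ) := fun m hm => by
    exact_mod_cast Nat.mul_pos (by omega) (Nat.choose_pos (by omega))
  set E : ℝ := (exPhi n k (⊤ : SimpleGraph (Fin (r + 1))) : ℝ) with hE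
  suffices h : exPhi n k H ≤ ⌊E + ε * (n : ℝ) ^ (k + 1)⌋₊ from
    (Nat.cast_le.2 h).trans (Nat.floor_le (by positivity))
  refine exPhi_le fun G hG => Nat.le_floor ?_
  have hstar := star_density_le hnpos G M k (r + 1)
  have hhom := hN₁ n hnN₁ G hG
  have hdesc := hN₂ n hnN₂
  have hquot := hMn n hkn
  have hfac : (k.factorial * ePhi G k : ℝ) ≤ ∑ v, (G.degree v : ℝ) ^ k := by
    exact_mod_cast factorial_mul_ePhi_le G k
  have hCn : (k.factorial : ℝ) * (n * (n - 1).choose k : ℕ) = n.descFactorial (k + 1) := by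
    exact_mod_cast factorial_mul_mul_choose_pred hnpos
  set P : ℝ := (n : ℝ) ^ (k + 1) with hP
  have hPpos : 0 < P := by positivity
  set a : ℝ := E / (n * (n - 1).choose k : ℕ) with ha
  have haE : a * (n * (n - 1).choose k : ℕ) = E := div_mul_cancel₀ _ (hCpos n hkn).ne'
  have ha0 : 0 ≤ a := by positivity
  have ha1 : a ≤ 1 := by
    refine (div_le_one (hCpos n hkn)).2 ?_
    exact Nat.cast_le.2 (exPhi_le fun G _ => ePhi_le G k)
  have hbad : (M : ℝ) ^ (r + 1) * (#{h : Fin (r + 1) → Fin n |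
      ∀ i j, i ≠ j → G.Adj (h i) (h j)} / (n : ℝ) ^ (r + 1)) ≤ ε / 3 := by
    rw [mul_comm, ← le_div_iff₀ (by positivity), div_le_iff₀ (by positivity)]
    exact hhom
  have hdens : (∑ v, (G.degree v : ℝ) ^ k) / P ≤ a + ε / 3 + ε / 3 := by
    have hCM := hCpos M hM
    have h1 : (∑ v, (G.degree v : ℝ) ^ k) / P ≤
        (exPhi M k (⊤ : SimpleGraph (Fin (r + 1))) : ℝ) / (M * (M - 1).choose k : ℕ) + ε / 3 := by
      refine le_of_mul_le_mul_left ?_ hCM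
      rw [mul_add, mul_div_cancel₀ _ hCM.ne']
      push_cast at hCM ⊢
      exact hstar.trans (add_le_add_right (mul_le_mul_of_nonneg_left hbad hCM.le) _)
    linarith
  rw [div_le_iff₀ hPpos] at hdens
  have hk1 : (1 : ℝ) ≤ k.factorial := by exact_mod_cast k.factorial_pos
  have h2 : a * (P - n.descFactorial (k + 1)) ≤ ε / 3 * P :=
    (mul_le_mul_of_nonneg_left hdesc ha0).trans (mul_le_of_le_one_left (by positivity) ha1)
  have h3 : a * n.descFactorial (k + 1) = k.factorial * E := by
    rw [← hCn, ← haE]; ring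
  have h4 : ε * P ≤ k.factorial * (ε * P) := le_mul_of_one_le_left (by positivity) hk1
  refine le_of_mul_le_mul_left (a := (k.factorial : ℝ)) ?_ (by linarith)
  linarith
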